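/- Let a, c, m be integers with gcd(am, c) = 1 and c, m ≥ 1. Then for all real Y ≥ 1, the number of squarefree integers 1 ≤ q ≤ Y with gcd(q, m) = 1 and q ≡ a (mod c) equals (6Y/(π²φ(c)))·∏_{p ∣ cm} p/(p+1) + O(Y^{1/2}·τ(m)), with an absolute implied constant. -/

import Mathlib

open Real

open scoped ArithmeticFunction.Moebius ArithmeticFunction.zeta

open ArithmeticFunction in
lemma sum_moebius_eq_ite_one {n : ℕ} : ∑ d ∈ n.divisors, (μ d : ℝ) = if n = 1 then 1 else 0 := by
  have h : ((ζ : ArithmeticFunction ℝ) * (μ : ArithmeticFunction ℝ)) n =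
      (1 : ArithmeticFunction ℝ) n := by rw [coe_zeta_mul_coe_moebius]
  rw [coe_zeta_mul_apply, one_apply] at h
  simpa only [intCoe_apply] using h

open ArithmeticFunction in
lemma sum_moebius_div_eq_totient_div (m : ℕ) (hm : 1 ≤ m) :
    ∑ e ∈ m.divisors, (μ e : ℝ) / e = (Nat.totient m : ℝ) / m := by
  have h := (sum_eq_iff_sum_mul_moebius_eq (R := ℝ) (f := fun n => (Nat.totient n : ℝ))
    (g := fun n => (n : ℝ))).1 (fun n _ => by exact_mod_cast Nat.sum_totient n) m hm
  rw [← h, Nat.sum_divisorsAntidiagonal (fun x y => (μ x : ℝ) * (y : ℝ)), Finset.sum_div]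
  refine Finset.sum_congr rfl fun e he => ?_
  have hd := Nat.dvd_of_mem_divisors he
  have he0 : (e : ℝ) ≠ 0 := by
    exact_mod_cast (Nat.pos_of_mem_divisors he).ne'
  have hm0 : (m : ℝ) ≠ 0 := by exact_mod_cast (by omega : m ≠ 0)
  rw [Nat.cast_div hd he0]
  field_simp

open ArithmeticFunction in
/-- The indicator function of the squarefree numbers is `∑ d² ∣ q, μ(d)`. -/
lemma sum_moebius_sq_dvd (q M : ℕ) (hq : 0 < q) (hM : Nat.sqrt q ≤ M) :
    ∑ d ∈ (Finset.Ioc 0 M).filter (fun d => d ^ 2 ∣ q), (μ d : ℝ) =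
      if Squarefree q then 1 else 0 := by
  obtain ⟨s, b, hs, hb, rfl, hsf⟩ := Nat.sq_mul_squarefree_of_pos hq
  have hset : (Finset.Ioc 0 M).filter (fun d => d ^ 2 ∣ b ^ 2 * s) = b.divisors := by
    ext d
    simp only [Finset.mem_filter, Finset.mem_Ioc, Nat.mem_divisors]
    constructor
    · rintro ⟨_, h⟩
      refine ⟨?_, hb.ne'⟩
      have hf := (Nat.factorization_le_iff_dvd (d := d ^ 2) (by simp; omega) hq.ne').2 h
      rw [← Nat.factorization_le_iff_dvd (by omega) hb.ne']
      intro p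
      have h1 := hf p
      have h2 := hsf.natFactorization_le_one p
      rw [Nat.factorization_mul (by positivity) hs.ne'] at h1
      simp at h1
      omega
    · rintro ⟨h, -⟩
      refine ⟨⟨Nat.pos_of_dvd_of_pos h hb, (Nat.le_of_dvd hb h).trans (le_trans ?_ hM)⟩,
        (pow_dvd_pow_of_dvd h 2).mul_right s⟩
      rw [Nat.le_sqrt']
      exact Nat.le_mul_of_pos_right _ hs
  rw [hset, sum_moebius_eq_ite_one]
  congr 1
  rw [eq_iff_iff]
  constructor
  · rintro rfl; simpa using hsf
  · intro h
    have := h b (by rw [← pow_two]; exact dvd_mul_right _ _)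
    simpa using this

/-- The number of `k ≤ X` in a residue class modulo `c` is `X / c + O(1)`. -/
lemma abs_card_modEq_sub_le (c : ℕ) (hc : 1 ≤ c) (v : ℕ) (X : ℝ) (hX : 0 ≤ X) :
    |(((Finset.Ioc 0 ⌊X⌋₊).filter (fun k => k ≡ v [MOD c])).card : ℝ) - X / c| ≤ 2 := by
  have h := Nat.Ioc_filter_modEq_card 0 ⌊X⌋₊ (r := c) hc v
  have hc' : (1 : ℝ) ≤ c := by exact_mod_cast hc
  have h2 : (((Finset.Ioc 0 ⌊X⌋₊).filter (fun k => k ≡ v [MOD c])).card : ℝ) =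
      max ((⌊((⌊X⌋₊ : ℚ) - v) / (c : ℚ)⌋ : ℝ) - (⌊(((0 : ℕ) : ℚ) - v) / (c : ℚ)⌋ : ℝ)) 0 := by
    exact_mod_cast congrArg (fun z : ℤ => (z : ℝ)) h
  rw [h2, max_eq_left]
  · have a1 := Int.floor_le (((⌊X⌋₊ : ℚ) - v) / (c : ℚ))
    have a2 := Int.lt_floor_add_one (((⌊X⌋₊ : ℚ) - v) / (c : ℚ))
    have b1 := Int.floor_le ((((0 : ℕ) : ℚ) - v) / (c : ℚ))
    have b2 := Int.lt_floor_add_one ((((0 : ℕ) : ℚ) - v) / (c : ℚ))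
    generalize ⌊((⌊X⌋₊ : ℚ) - v) / (c : ℚ)⌋ = A at *
    generalize ⌊(((0 : ℕ) : ℚ) - v) / (c : ℚ)⌋ = B at *
    have a1 : (A : ℝ) ≤ ((⌊X⌋₊ : ℝ) - v) / c := by exact_mod_cast (Rat.cast_le (K := ℝ)).2 a1
    have a2 : ((⌊X⌋₊ : ℝ) - v) / c < A + 1 := by exact_mod_cast (Rat.cast_lt (K := ℝ)).2 a2
    have b1 : (B : ℝ) ≤ ((0 : ℝ) - v) / c := by exact_mod_cast (Rat.cast_le (K := ℝ)).2 b1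
    have b2 : ((0 : ℝ) - v) / c < B + 1 := by exact_mod_cast (Rat.cast_lt (K := ℝ)).2 b2
    have f1 := Nat.floor_le hX
    have f2 := Nat.lt_floor_add_one X
    have g1 : (⌊X⌋₊ : ℝ) / c ≤ X / c := by gcongr
    have g2 : X / c ≤ ⌊X⌋₊ / c + 1 := by
      rw [div_add_one (by positivity)]; gcongr; linarith
    rw [sub_div] at *
    rw [zero_div] at b1 b2
    rw [abs_le]; constructor <;> linarith
  · rw [sub_nonneg]
    have h0 : ⌊(((0 : ℕ) : ℚ) - v) / (c : ℚ)⌋ ≤ ⌊((⌊X⌋₊ : ℚ) - v) / (c : ℚ)⌋ :=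
      Int.floor_le_floor (by gcongr; exact Nat.zero_le _)
    exact_mod_cast h0

/-- A linear congruence with invertible leading coefficient has exactly one solution class. -/
lemma exists_dvd_mul_sub_iff_modEq (c w : ℕ) (hc : 1 ≤ c) (hw : w.Coprime c) (a : ℤ) :
    ∃ v : ℕ, ∀ k : ℕ, (c : ℤ) ∣ (k : ℤ) * w - a ↔ k ≡ v [MOD c] := by
  have : NeZero c := ⟨by omega⟩
  refine ⟨(((w : ZMod c))⁻¹ * (a : ZMod c)).val, fun k => ?_⟩
  have hu : (w : ZMod c) * (w : ZMod c)⁻¹ = 1 := ZMod.coe_mul_inv_eq_one w hw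
  rw [← ZMod.natCast_eq_natCast_iff, ZMod.natCast_zmod_val, ← ZMod.intCast_zmod_eq_zero_iff_dvd]
  push_cast
  rw [sub_eq_zero]
  constructor
  · intro h; rw [← h]; linear_combination (-(k : ZMod c)) * hu
  · intro h; rw [h]; linear_combination (a : ZMod c) * hu

/-- Multiples of `e` up to `X` correspond to integers up to `X / e`. -/
lemma card_filter_dvd_eq (c e u : ℕ) (he : 0 < e) (a : ℤ) (X : ℝ) (v : ℕ)
    (hv : ∀ k : ℕ, (c : ℤ) ∣ (k : ℤ) * ((e * u : ℕ) : ℤ) - a ↔ k ≡ v [MOD c]) :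
    ((Finset.Ioc 0 ⌊X⌋₊).filter (fun n : ℕ => e ∣ n ∧ (c : ℤ) ∣ (n : ℤ) * u - a)).card =
      ((Finset.Ioc 0 ⌊X / e⌋₊).filter (fun k => k ≡ v [MOD c])).card := by
  symm
  refine Finset.card_bij (fun k _ => e * k) ?_ ?_ ?_
  · intro k hk
    simp only [Finset.mem_filter, Finset.mem_Ioc] at hk ⊢
    obtain ⟨⟨h1, h2⟩, h3⟩ := hk
    rw [Nat.floor_div_natCast, Nat.le_div_iff_mul_le he] at h2
    refine ⟨⟨by positivity, by linarith⟩, dvd_mul_right _ _, ?_⟩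
    convert (hv k).2 h3 using 2
    push_cast; ring
  · intro k _ l _ h
    exact Nat.eq_of_mul_eq_mul_left he h
  · intro n hn
    simp only [Finset.mem_filter, Finset.mem_Ioc] at hn
    obtain ⟨⟨h1, h2⟩, ⟨k, rfl⟩, h3⟩ := hn
    refine ⟨k, ?_, rfl⟩
    simp only [Finset.mem_filter, Finset.mem_Ioc]
    refine ⟨⟨Nat.pos_of_mul_pos_left h1, ?_⟩, (hv k).1 ?_⟩
    · rw [Nat.floor_div_natCast, Nat.le_div_iff_mul_le he]; linarith
    · convert h3 using 2
      push_cast; ring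

/-- The number of `n ≤ X` coprime to `m` solving a linear congruence modulo `c`. -/
lemma abs_card_coprime_sub_le (a : ℤ) (c m u : ℕ) (hc : 1 ≤ c) (hm : 1 ≤ m)
    (hmc : m.Coprime c) (huc : u.Coprime c) (X : ℝ) (hX : 0 ≤ X) :
    |(((Finset.Ioc 0 ⌊X⌋₊).filter
        (fun n : ℕ => n.Coprime m ∧ (c : ℤ) ∣ (n : ℤ) * u - a)).card : ℝ) -
      (Nat.totient m : ℝ) / m * (X / c)| ≤ 2 * m.divisors.card := by
  have key : (((Finset.Ioc 0 ⌊X⌋₊).filter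
        (fun n : ℕ => n.Coprime m ∧ (c : ℤ) ∣ (n : ℤ) * u - a)).card : ℝ) =
      ∑ e ∈ m.divisors, (μ e : ℝ) * (((Finset.Ioc 0 ⌊X⌋₊).filter
        (fun n : ℕ => e ∣ n ∧ (c : ℤ) ∣ (n : ℤ) * u - a)).card : ℝ) := by
    simp_rw [Finset.card_filter, Nat.cast_sum, Finset.mul_sum]
    rw [Finset.sum_comm]
    refine Finset.sum_congr rfl fun n _ => ?_
    by_cases h : (c : ℤ) ∣ (n : ℤ) * u - a
    · have hg : (n.gcd m).divisors = m.divisors.filter (fun e => e ∣ n) := by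
        ext e
        simp only [Nat.mem_divisors, Finset.mem_filter, Nat.dvd_gcd_iff, ne_eq,
          Nat.gcd_eq_zero_iff]
        constructor
        · rintro ⟨⟨h1, h2⟩, -⟩; exact ⟨⟨h2, by omega⟩, h1⟩
        · rintro ⟨⟨h1, -⟩, h2⟩; exact ⟨⟨h2, h1⟩, by omega⟩
      have hs := sum_moebius_eq_ite_one (n := n.gcd m)
      rw [hg, Finset.sum_filter] at hs
      simp only [h, and_true, Nat.Coprime]
      simp only [Nat.cast_ite, Nat.cast_one, Nat.cast_zero, mul_ite, mul_one, mul_zero]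
      exact hs.symm
    · simp [h]
  have key2 : (Nat.totient m : ℝ) / m * (X / c) =
      ∑ e ∈ m.divisors, (μ e : ℝ) * (X / e / c) := by
    rw [← sum_moebius_div_eq_totient_div m hm, Finset.sum_mul]
    exact Finset.sum_congr rfl fun e _ => by ring
  rw [key, key2, ← Finset.sum_sub_distrib]
  refine (Finset.abs_sum_le_sum_abs _ _).trans ?_
  rw [mul_comm, ← nsmul_eq_mul]
  refine Finset.sum_le_card_nsmul _ _ _ fun e he => ?_
  have he0 := Nat.pos_of_mem_divisors he
  obtain ⟨v, hv⟩ := exists_dvd_mul_sub_iff_modEq c (e * u) hc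
    ((hmc.coprime_dvd_left (Nat.dvd_of_mem_divisors he)).mul_left huc) a
  rw [card_filter_dvd_eq c e u he0 a X v hv, ← mul_sub, abs_mul]
  have h1 : |(μ e : ℝ)| ≤ 1 := by exact_mod_cast ArithmeticFunction.abs_moebius_le_one
  have h2 := abs_card_modEq_sub_le c hc v (X / e) (by positivity)
  exact (mul_le_mul h1 h2 (abs_nonneg _) zero_le_one).trans_eq (one_mul 2)

/-- The function `d ↦ μ(d) / d²` restricted to `d` coprime to `K`. -/
noncomputable def coprimeMoebiusTerm (K d : ℕ) : ℝ :=
  if d.Coprime K then (μ d : ℝ) / (d : ℝ) ^ 2 else 0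

lemma abs_coprimeMoebiusTerm_le (K d : ℕ) : |coprimeMoebiusTerm K d| ≤ ((d : ℝ) ^ 2)⁻¹ := by
  unfold coprimeMoebiusTerm
  split_ifs
  · have h1 : |(μ d : ℝ)| ≤ 1 := by exact_mod_cast ArithmeticFunction.abs_moebius_le_one
    rw [abs_div, abs_of_nonneg (by positivity : (0 : ℝ) ≤ (d : ℝ) ^ 2), inv_eq_one_div]
    gcongr
  · simp

lemma hasSum_coprimeMoebiusTerm (K : ℕ) (hK : 1 ≤ K) :
    HasSum (coprimeMoebiusTerm K)
      (6 / π ^ 2 * ∏ p ∈ K.primeFactors, (1 - ((p : ℝ) ^ 2)⁻¹)⁻¹) := by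
  have : NeZero K := ⟨by omega⟩
  have hs : Summable (coprimeMoebiusTerm K) := by
    refine Summable.of_norm_bounded (Real.summable_nat_pow_inv.2 one_lt_two) fun d => ?_
    exact abs_coprimeMoebiusTerm_le K d
  have h2 : (1 : ℝ) < (2 : ℂ).re := by norm_num
  have h := DirichletCharacter.LSeries.mul_mu_eq_one (1 : DirichletCharacter ℂ K) h2
  rw [← DirichletCharacter.LFunction_eq_LSeries _ h2] at h
  have h3 := DirichletCharacter.LFunctionTrivChar_eq_mul_riemannZeta (N := K) (s := 2) (by norm_num)
  unfold DirichletCharacter.LFunctionTrivChar at h3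
  rw [h3, riemannZeta_two, LSeries] at h
  have hterm : ∀ d : ℕ, LSeries.term ((fun n : ℕ => (1 : DirichletCharacter ℂ K) n) *
      (fun n : ℕ => ((μ n : ℤ) : ℂ))) 2 d = ((coprimeMoebiusTerm K d : ℝ) : ℂ) := by
    intro d
    rcases Nat.eq_zero_or_pos d with rfl | hd
    · simp [coprimeMoebiusTerm]
    · rw [LSeries.term_of_ne_zero hd.ne']
      unfold coprimeMoebiusTerm
      split_ifs with hco
      · rw [Pi.mul_apply, MulChar.one_apply ((ZMod.isUnit_iff_coprime d K).2 hco)]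
        simp
      · rw [Pi.mul_apply, MulChar.map_nonunit _ (mt (ZMod.isUnit_iff_coprime d K).1 hco)]
        simp
  have hsum : ∑' d, LSeries.term ((fun n : ℕ => (1 : DirichletCharacter ℂ K) n) *
      (fun n : ℕ => ((μ n : ℤ) : ℂ))) 2 d = ((∑' d, coprimeMoebiusTerm K d : ℝ) : ℂ) := by
    rw [Complex.ofReal_tsum]; exact tsum_congr hterm
  rw [hsum] at h
  have hp : (∏ p ∈ K.primeFactors, (1 - (p : ℂ) ^ (-2 : ℂ))) =
      ((∏ p ∈ K.primeFactors, (1 - ((p : ℝ) ^ 2)⁻¹) : ℝ) : ℂ) := by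
    push_cast
    refine Finset.prod_congr rfl fun p _ => ?_
    rw [Complex.cpow_neg]; norm_num
  rw [hp] at h
  have h' : (∏ p ∈ K.primeFactors, (1 - ((p : ℝ) ^ 2)⁻¹)) * (π ^ 2 / 6) *
      ∑' d, coprimeMoebiusTerm K d = 1 := by exact_mod_cast h
  convert hs.hasSum using 1
  rw [Finset.prod_inv_distrib]
  have hne : (∏ p ∈ K.primeFactors, (1 - ((p : ℝ) ^ 2)⁻¹)) ≠ 0 := by
    intro h0; rw [h0] at h'; simp at h'
  generalize ∏ p ∈ K.primeFactors, (1 - ((p : ℝ) ^ 2)⁻¹) = P at h' hne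
  field_simp
  linarith

lemma abs_sum_coprimeMoebiusTerm_sub_le (K M : ℕ) (hM : 1 ≤ M) {S : ℝ}
    (hS : HasSum (coprimeMoebiusTerm K) S) :
    |∑ d ∈ Finset.Ioc 0 M, coprimeMoebiusTerm K d - S| ≤ 1 / M := by
  have hIoc : ∀ n : ℕ, ∑ d ∈ Finset.range (n + 1), coprimeMoebiusTerm K d =
      ∑ d ∈ Finset.Ioc 0 n, coprimeMoebiusTerm K d := by
    intro n
    rw [Finset.range_eq_Ico, ← Finset.sum_subset]
    · intro d hd; simp only [Finset.mem_Ioc, Finset.mem_Ico] at *; omega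
    · intro d hd hd'
      obtain rfl : d = 0 := by simp only [Finset.mem_Ioc, Finset.mem_Ico] at *; omega
      simp [coprimeMoebiusTerm]
  have ht := ((Filter.tendsto_add_atTop_iff_nat 1).2 hS.tendsto_sum_nat).const_sub
    (∑ d ∈ Finset.Ioc 0 M, coprimeMoebiusTerm K d)
  refine le_of_tendsto ht.abs (Filter.eventually_atTop.2 ⟨M, fun n hn => ?_⟩)
  rw [hIoc, abs_sub_comm, ← Finset.sum_Ioc_consecutive _ (Nat.zero_le M) hn, add_sub_cancel_left]
  calc _ ≤ ∑ d ∈ Finset.Ioc M n, |coprimeMoebiusTerm K d| := Finset.abs_sum_le_sum_abs _ _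
    _ ≤ ∑ d ∈ Finset.Ioc M n, ((d : ℝ) ^ 2)⁻¹ :=
      Finset.sum_le_sum fun d _ => abs_coprimeMoebiusTerm_le K d
    _ ≤ (M : ℝ)⁻¹ - (n : ℝ)⁻¹ := sum_Ioc_inv_sq_le_sub (by omega) hn
    _ ≤ 1 / M := by
      rw [one_div, sub_le_self_iff]; positivity

/-- Sorting the squarefree numbers in a residue class by their square divisors. -/
lemma card_squarefree_eq_sum (a : ℤ) (c m N : ℕ) :
    (((Finset.Ioc 0 N).filter (fun q : ℕ => Squarefree q ∧ q.Coprime m ∧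
      (c : ℤ) ∣ (q : ℤ) - a)).card : ℝ) =
    ∑ d ∈ Finset.Ioc 0 N.sqrt, (μ d : ℝ) * (((Finset.Ioc 0 N).filter
      (fun q : ℕ => d ^ 2 ∣ q ∧ q.Coprime m ∧ (c : ℤ) ∣ (q : ℤ) - a)).card : ℝ) := by
  simp_rw [Finset.card_filter, Nat.cast_sum, Finset.mul_sum]
  rw [Finset.sum_comm]
  refine Finset.sum_congr rfl fun q hq => ?_
  rw [Finset.mem_Ioc] at hq
  by_cases h : q.Coprime m ∧ (c : ℤ) ∣ (q : ℤ) - a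
  · have hs := sum_moebius_sq_dvd q N.sqrt hq.1 (Nat.sqrt_le_sqrt hq.2)
    rw [Finset.sum_filter] at hs
    simp only [eq_true h.1, eq_true h.2, and_true]
    simp only [Nat.cast_ite, Nat.cast_one, Nat.cast_zero, mul_ite, mul_one, mul_zero]
    exact hs.symm
  · simp [h]

lemma card_filter_sq_dvd_eq (a : ℤ) (c m d : ℕ) (hd : 0 < d) (hdm : d.Coprime m) (Y : ℝ) :
    ((Finset.Ioc 0 ⌊Y⌋₊).filter
      (fun q : ℕ => d ^ 2 ∣ q ∧ q.Coprime m ∧ (c : ℤ) ∣ (q : ℤ) - a)).card =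
    ((Finset.Ioc 0 ⌊Y / (d : ℝ) ^ 2⌋₊).filter
      (fun n : ℕ => n.Coprime m ∧ (c : ℤ) ∣ (n : ℤ) * ((d ^ 2 : ℕ) : ℤ) - a)).card := by
  have hd2 : 0 < d ^ 2 := by positivity
  have hfl : ⌊Y / (d : ℝ) ^ 2⌋₊ = ⌊Y⌋₊ / d ^ 2 := by
    rw [← Nat.floor_div_natCast]; push_cast; rfl
  rw [hfl]
  symm
  refine Finset.card_bij (fun n _ => d ^ 2 * n) ?_ ?_ ?_
  · intro k hk
    simp only [Finset.mem_filter, Finset.mem_Ioc] at hk ⊢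
    obtain ⟨⟨h1, h2⟩, h3, h4⟩ := hk
    rw [Nat.le_div_iff_mul_le hd2] at h2
    refine ⟨⟨by positivity, by linarith⟩, dvd_mul_right _ _, (hdm.pow_left 2).mul_left h3, ?_⟩
    convert h4 using 2
    push_cast; ring
  · intro k _ l _ h
    exact Nat.eq_of_mul_eq_mul_left hd2 h
  · intro n hn
    simp only [Finset.mem_filter, Finset.mem_Ioc] at hn
    obtain ⟨⟨h1, h2⟩, ⟨k, rfl⟩, h3, h4⟩ := hn
    refine ⟨k, ?_, rfl⟩
    simp only [Finset.mem_filter, Finset.mem_Ioc]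
    refine ⟨⟨Nat.pos_of_mul_pos_left h1, ?_⟩, Nat.Coprime.coprime_mul_left h3, ?_⟩
    · rw [Nat.le_div_iff_mul_le hd2]; linarith
    · convert h4 using 2
      push_cast; ring

lemma abs_card_sq_dvd_sub_le (a : ℤ) (c m d : ℕ) (hc : 1 ≤ c) (hm : 1 ≤ m) (hd : 0 < d)
    (hmc : m.Coprime c) (hac : IsCoprime a (c : ℤ)) (Y : ℝ) (hY : 0 ≤ Y) :
    |(μ d : ℝ) * (((Finset.Ioc 0 ⌊Y⌋₊).filter
      (fun q : ℕ => d ^ 2 ∣ q ∧ q.Coprime m ∧ (c : ℤ) ∣ (q : ℤ) - a)).card : ℝ) -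
      (Nat.totient m : ℝ) / m * (Y / c) * coprimeMoebiusTerm (c * m) d| ≤
      2 * m.divisors.card := by
  unfold coprimeMoebiusTerm
  split_ifs with hco
  · have hdc : d.Coprime c := hco.coprime_mul_right_right
    have hdm : d.Coprime m := hco.coprime_mul_left_right
    rw [card_filter_sq_dvd_eq a c m d hd hdm Y]
    have h2 := abs_card_coprime_sub_le a c m (d ^ 2) hc hm hmc (hdc.pow_left 2)
      (Y / (d : ℝ) ^ 2) (by positivity)
    have h1 : |(μ d : ℝ)| ≤ 1 := by exact_mod_cast ArithmeticFunction.abs_moebius_le_one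
    have hr : (Nat.totient m : ℝ) / m * (Y / c) * ((μ d : ℝ) / (d : ℝ) ^ 2) =
        (μ d : ℝ) * ((Nat.totient m : ℝ) / m * (Y / (d : ℝ) ^ 2 / c)) := by ring
    rw [hr, ← mul_sub, abs_mul]
    exact (mul_le_mul h1 h2 (abs_nonneg _) zero_le_one).trans_eq (one_mul _)
  · have hempty : (Finset.Ioc 0 ⌊Y⌋₊).filter
        (fun q : ℕ => d ^ 2 ∣ q ∧ q.Coprime m ∧ (c : ℤ) ∣ (q : ℤ) - a) = ∅ := by
      refine Finset.filter_eq_empty_iff.2 fun q _ ⟨h1, h2, h3⟩ => hco ?_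
      have hdq : d ∣ q := (dvd_pow_self d two_ne_zero).trans h1
      refine Nat.Coprime.mul_right (Nat.Coprime.coprime_dvd_left hdq ?_)
        (Nat.Coprime.coprime_dvd_left hdq h2)
      rw [← Nat.isCoprime_iff_coprime]
      obtain ⟨t, ht⟩ := h3
      have hq : (q : ℤ) = a + c * t := by linarith
      rw [hq]
      exact hac.add_mul_left_left t
    rw [hempty]
    simp

lemma totient_div_mul_eq (c m : ℕ) (hc : 1 ≤ c) (hm : 1 ≤ m) (hmc : m.Coprime c) (Y : ℝ) :
    (Nat.totient m : ℝ) / m * (Y / c) *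
      (6 / π ^ 2 * ∏ p ∈ (c * m).primeFactors, (1 - ((p : ℝ) ^ 2)⁻¹)⁻¹) =
    6 * Y / (π ^ 2 * (Nat.totient c)) * ∏ p ∈ (c * m).primeFactors, (p : ℝ) / (p + 1) := by
  have h : ((Nat.totient (c * m) : ℕ) : ℝ) =
      ((c * m : ℕ) : ℝ) * ∏ p ∈ (c * m).primeFactors, (1 - (p : ℝ)⁻¹) := by
    have h0 := congrArg (Rat.cast : ℚ → ℝ) (Nat.totient_eq_mul_prod_factors (c * m))
    push_cast at h0 ⊢
    exact h0
  rw [Nat.totient_mul hmc.symm] at h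
  push_cast at h
  have hp : ∏ p ∈ (c * m).primeFactors, (p : ℝ) / (p + 1) =
      (∏ p ∈ (c * m).primeFactors, (1 - ((p : ℝ) ^ 2)⁻¹)⁻¹) *
        ∏ p ∈ (c * m).primeFactors, (1 - (p : ℝ)⁻¹) := by
    rw [← Finset.prod_mul_distrib]
    refine Finset.prod_congr rfl fun p hp => ?_
    have hp1 : (1 : ℝ) < p := by exact_mod_cast (Nat.prime_of_mem_primeFactors hp).one_lt
    have e1 : (1 - ((p : ℝ) ^ 2)⁻¹) = (p - 1) * (p + 1) / p ^ 2 := by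
      field_simp; ring
    have e2 : (p : ℝ) - 1 ≠ 0 := by linarith
    rw [e1]
    field_simp
  rw [hp]
  have h1 : (0 : ℝ) < Nat.totient c := by exact_mod_cast Nat.totient_pos.2 hc
  have hc' : (0 : ℝ) < c := by exact_mod_cast hc
  have hm' : (0 : ℝ) < m := by exact_mod_cast hm
  generalize ∏ p ∈ (c * m).primeFactors, (1 - ((p : ℝ) ^ 2)⁻¹)⁻¹ = P
  generalize ∏ p ∈ (c * m).primeFactors, (1 - (p : ℝ)⁻¹) = Q at *
  field_simp
  linear_combination Y * P * h


/-- For integers `a`, `c ≥ 1`, `m ≥ 1` with `gcd(am, c) = 1` and real `Y ≥ 1`,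
the number of squarefree `1 ≤ q ≤ Y` with `gcd(q,m) = 1` and `q ≡ a (mod c)` equals
`(6Y/(π²φ(c)))·∏_{p ∣ cm} p/(p+1) + O(√Y·τ(m))`, with an absolute implied constant. -/
theorem stmt9 :
    ∃ C : ℝ, 0 < C ∧ ∀ (a : ℤ) (c m : ℕ), 1 ≤ c → 1 ≤ m →
      IsCoprime (a * (m : ℤ)) (c : ℤ) → ∀ Y : ℝ, 1 ≤ Y →
      |(Nat.card {q : ℕ | 1 ≤ q ∧ (q : ℝ) ≤ Y ∧ Squarefree q ∧ Nat.Coprime q m ∧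
          (c : ℤ) ∣ (q : ℤ) - a} : ℝ) -
        6 * Y / (π ^ 2 * (Nat.totient c)) * ∏ p ∈ (c * m).primeFactors, (p : ℝ) / (p + 1)|
      ≤ C * Real.sqrt Y * (Nat.divisors m).card := by
  refine ⟨4, by norm_num, fun a c m hc hm hcop Y hY => ?_⟩
  have hac : IsCoprime a (c : ℤ) := hcop.of_mul_left_left
  have hmc : m.Coprime c := Nat.isCoprime_iff_coprime.1 hcop.of_mul_left_right
  have hY0 : 0 ≤ Y := by linarith
  have hset : {q : ℕ | 1 ≤ q ∧ (q : ℝ) ≤ Y ∧ Squarefree q ∧ Nat.Coprime q m ∧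
      (c : ℤ) ∣ (q : ℤ) - a} = ↑((Finset.Ioc 0 ⌊Y⌋₊).filter (fun q : ℕ => Squarefree q ∧
        q.Coprime m ∧ (c : ℤ) ∣ (q : ℤ) - a)) := by
    ext q
    simp only [Set.mem_ofPred_eq, Finset.coe_filter, Finset.mem_Ioc, Nat.le_floor_iff hY0,
      Nat.lt_iff_add_one_le, zero_add, and_assoc]
  rw [hset, Nat.card_coe_set_eq, Set.ncard_coe_finset, card_squarefree_eq_sum,
    ← totient_div_mul_eq c m hc hm hmc Y]
  have hS := hasSum_coprimeMoebiusTerm (c * m) (Nat.mul_pos hc hm)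
  set S := 6 / π ^ 2 * ∏ p ∈ (c * m).primeFactors, (1 - ((p : ℝ) ^ 2)⁻¹)⁻¹
  set M := ⌊Y⌋₊.sqrt
  have hM1 : 1 ≤ M := Nat.le_sqrt.2 (Nat.le_floor (by simpa using hY))
  have htail := abs_sum_coprimeMoebiusTerm_sub_le (c * m) M hM1 hS
  set F := (Nat.totient m : ℝ) / m * (Y / c)
  have hc' : (1 : ℝ) ≤ c := by exact_mod_cast hc
  have hm' : (0 : ℝ) < m := by exact_mod_cast hm
  have hF0 : 0 ≤ F := by positivity
  have hFY : F ≤ Y := by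
    have h1 : (Nat.totient m : ℝ) / m ≤ 1 :=
      (div_le_one hm').2 (by exact_mod_cast Nat.totient_le m)
    exact (mul_le_mul h1 (div_le_self hY0 hc') (by positivity) zero_le_one).trans_eq (one_mul Y)
  have hsum : |∑ d ∈ Finset.Ioc 0 M, (μ d : ℝ) * (((Finset.Ioc 0 ⌊Y⌋₊).filter
      (fun q : ℕ => d ^ 2 ∣ q ∧ q.Coprime m ∧ (c : ℤ) ∣ (q : ℤ) - a)).card : ℝ) -
      F * ∑ d ∈ Finset.Ioc 0 M, coprimeMoebiusTerm (c * m) d| ≤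
      M * (2 * m.divisors.card) := by
    rw [Finset.mul_sum, ← Finset.sum_sub_distrib]
    refine (Finset.abs_sum_le_sum_abs _ _).trans ?_
    refine (Finset.sum_le_card_nsmul _ _ (2 * (m.divisors.card : ℝ)) fun d hd => ?_).trans ?_
    · exact abs_card_sq_dvd_sub_le a c m d hc hm (Finset.mem_Ioc.1 hd).1 hmc hac Y hY0
    · simp
  have hmain : |F * ∑ d ∈ Finset.Ioc 0 M, coprimeMoebiusTerm (c * m) d - F * S| ≤
      Y * (1 / M) := by
    rw [← mul_sub, abs_mul, abs_of_nonneg hF0]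
    exact mul_le_mul hFY htail (abs_nonneg _) hY0
  have hMY : (M : ℝ) ≤ √Y := by
    refine Real.le_sqrt_of_sq_le ?_
    refine le_trans ?_ (Nat.floor_le hY0)
    exact_mod_cast Nat.sqrt_le' ⌊Y⌋₊
  have hYM : √Y ≤ 2 * M := by
    have h1 : √Y ≤ M + 1 := by
      rw [Real.sqrt_le_left (by positivity)]
      refine (Nat.lt_floor_add_one Y).le.trans ?_
      exact_mod_cast Nat.lt_succ_sqrt' ⌊Y⌋₊
    have : (1 : ℝ) ≤ M := by exact_mod_cast hM1
    linarith
  have hM0 : (0 : ℝ) < M := by exact_mod_cast hM1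
  have hdiv : Y * (1 / M) ≤ 2 * √Y := by
    rw [mul_one_div, div_le_iff₀ hM0]
    nlinarith [Real.mul_self_sqrt hY0, Real.sqrt_nonneg Y]
  have htau : (1 : ℝ) ≤ m.divisors.card := by
    exact_mod_cast Finset.card_pos.2 (Nat.nonempty_divisors.2 (by omega))
  refine (abs_sub_le _ _ _).trans ((add_le_add hsum hmain).trans ?_)
  nlinarith [mul_le_mul_of_nonneg_right hMY (by linarith : (0 : ℝ) ≤ m.divisors.card),
    mul_le_mul_of_nonneg_left htau (Real.sqrt_nonneg Y)]
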